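/- arXiv:2402.07563 — 8 statements merged into one kernel-verified Lean document; each statement's English description precedes it below -/
import Mathlib

section
/- For every natural number m with m ≥ 2, the function (n, ε) ↦ f(m, n, ε) tends to m²/(m² − 1) as n → ∞ and ε → 1 from below, i.e., along the product of the atTop filter on ℕ and the left-neighborhood filter 𝓝[<] 1 on ℝ. In particular, f(2, n, ε) → 4/3 and f(3, n, ε) → 9/8. -/
open Filter Topology

/-- `f(m, n, ε) = ((m·ε·n + 1)/((m·ε + 1)·n + 1)) · ((((m−1)·ε + 1)·n + 1)/((m−1)·ε·n + 1))`. -/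
noncomputable def f (m n : ℕ) (ε : ℝ) : ℝ :=
  (((m : ℝ) * ε * n + 1) / (((m : ℝ) * ε + 1) * n + 1)) *
    (((((m : ℝ) - 1) * ε + 1) * n + 1) / (((m : ℝ) - 1) * ε * n + 1))

/-- If `a → A`, `b → B ≠ 0` and `x → ∞`, then `(a x + 1) / (b x + 1) → A / B`. -/
theorem tendsto_mul_add_one_div_mul_add_one {α : Type*} {l : Filter α} {a b x : α → ℝ} {A B : ℝ}
    (ha : Tendsto a l (𝓝 A)) (hb : Tendsto b l (𝓝 B)) (hx : Tendsto x l atTop) (hB : B ≠ 0) :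
    Tendsto (fun p => (a p * x p + 1) / (b p * x p + 1)) l (𝓝 (A / B)) := by
  have hinv : Tendsto (fun p => (x p)⁻¹) l (𝓝 0) := tendsto_inv_atTop_zero.comp hx
  have key := (ha.add hinv).div (hb.add hinv) (by simpa using hB)
  rw [add_zero, add_zero] at key
  refine key.congr' ?_
  filter_upwards [hx.eventually_gt_atTop 0] with p hp
  rw [Pi.div_apply, ← mul_div_mul_right _ _ hp.ne', add_mul, add_mul, inv_mul_cancel₀ hp.ne']

/-- The limit of `f m` along `n → ∞`, `ε → 1⁻`. -/
theorem f_tendsto_of_two_le (m : ℕ) (hm : 2 ≤ m) :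
    Tendsto (fun p : ℕ × ℝ => f m p.1 p.2)
      (atTop ×ˢ 𝓝[<] (1 : ℝ)) (𝓝 ((m : ℝ) ^ 2 / ((m : ℝ) ^ 2 - 1))) := by
  have hm' : (2 : ℝ) ≤ m := by exact_mod_cast hm
  have hn : Tendsto (fun p : ℕ × ℝ => (p.1 : ℝ)) (atTop ×ˢ 𝓝[<] (1 : ℝ)) atTop :=
    tendsto_natCast_atTop_atTop.comp tendsto_fst
  have hε : Tendsto (fun p : ℕ × ℝ => p.2) (atTop ×ˢ 𝓝[<] (1 : ℝ)) (𝓝 1) :=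
    tendsto_snd.mono_right nhdsWithin_le_nhds
  have h₁ := hε.const_mul (m : ℝ)
  have h₂ := hε.const_mul ((m : ℝ) - 1)
  have hne : (m : ℝ) - 1 ≠ 0 := by linarith
  have hne' : (m : ℝ) + 1 ≠ 0 := by linarith
  have key := (tendsto_mul_add_one_div_mul_add_one h₁ (h₁.add_const 1) hn (by simpa using hne')).mul
    (tendsto_mul_add_one_div_mul_add_one (h₂.add_const 1) h₂ hn (by simpa using hne))
  have hlim : (m : ℝ) ^ 2 / ((m : ℝ) ^ 2 - 1) =
      m * 1 / (m * 1 + 1) * (((m - 1) * 1 + 1) / ((m - 1) * 1)) := by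
    rw [div_mul_div_comm]
    congr 1 <;> ring
  rw [hlim]
  exact key

/-- For every `m ≥ 2`, `f(m, n, ε)` tends to `m²/(m² − 1)` as `n → ∞` and `ε → 1⁻`;
in particular `f(2, n, ε) → 4/3` and `f(3, n, ε) → 9/8`. -/
theorem f_tendsto :
    (∀ m : ℕ, 2 ≤ m →
      Tendsto (fun p : ℕ × ℝ => f m p.1 p.2)
        (atTop ×ˢ 𝓝[<] (1 : ℝ)) (𝓝 ((m : ℝ) ^ 2 / ((m : ℝ) ^ 2 - 1)))) ∧
    Tendsto (fun p : ℕ × ℝ => f 2 p.1 p.2)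
      (atTop ×ˢ 𝓝[<] (1 : ℝ)) (𝓝 ((4 : ℝ) / 3)) ∧
    Tendsto (fun p : ℕ × ℝ => f 3 p.1 p.2)
      (atTop ×ˢ 𝓝[<] (1 : ℝ)) (𝓝 ((9 : ℝ) / 8)) := by
  refine ⟨f_tendsto_of_two_le, ?_, ?_⟩
  · convert f_tendsto_of_two_le 2 le_rfl using 2
    norm_num
  · convert f_tendsto_of_two_le 3 (by norm_num) using 2
    norm_num
end

section
/- The function (n, ε) ↦ f(1, n, ε) tends to +∞ (i.e., tends to the atTop filter) as n → ∞ and ε → 1 from below, along the product of the atTop filter on ℕ and the left-neighborhood filter 𝓝[<] 1 on ℝ. -/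
open Filter Topology

/-- `f(1, n, ε)` tends to `+∞` as `n → ∞` and `ε → 1⁻`. -/
theorem f_one_tendsto_atTop :
    Tendsto (fun p : ℕ × ℝ => f 1 p.1 p.2)
      (atTop ×ˢ 𝓝[<] (1 : ℝ)) atTop := by
  have hε : ∀ᶠ ε : ℝ in 𝓝[<] 1, 1 / 2 < ε :=
    eventually_nhdsWithin_of_eventually_nhds (eventually_gt_nhds (by norm_num))
  have hn : Tendsto (fun p : ℕ × ℝ => (p.1 : ℝ) * (1 / 4))
      (atTop ×ˢ 𝓝[<] (1 : ℝ)) atTop :=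
    (tendsto_natCast_atTop_atTop.comp tendsto_fst).atTop_mul_const (by norm_num)
  refine tendsto_atTop_mono' _ ?_ hn
  filter_upwards [hε.prod_inr atTop] with ⟨n, ε⟩ h
  have hn0 : (0 : ℝ) ≤ n := n.cast_nonneg
  have h_ratio : 1 / 4 ≤ (ε * n + 1) / ((ε + 1) * n + 1) := by
    rw [div_le_div_iff₀ (by norm_num) (by positivity)]
    nlinarith
  simp only [f, Nat.cast_one, one_mul, sub_self, zero_mul, zero_add, div_one]
  nlinarith
end

section
/- Let G be a simple graph on a finite vertex set V in which every vertex has degree at most 3, and let Ṽ ⊆ V be a subset that is not an independent set of G. Then there exist a vertex v ∈ Ṽ, a natural number N, and ε₀ ∈ (0, 1) such that for all natural numbers n ≥ N and all ε ∈ (ε₀, 1), R^s(Ṽ \ {v}, n, ε) > R^s(Ṽ, n, ε). -/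
open Filter Topology

/-- The number `N_Ṽ(v)` of vertices of `Ṽ` adjacent to `v`. -/
def numAdj {V : Type*} [DecidableEq V] (G : SimpleGraph V) [DecidableRel G.Adj]
    (T : Finset V) (v : V) : ℕ :=
  (T.filter (fun u => G.Adj v u)).card

/-- The sum rate `R^s(Ṽ, n, ε) = ∑_{v ∈ Ṽ} log₂(1 + n/(1 + N_Ṽ(v)·ε·n))`. -/
noncomputable def sumRate {V : Type*} [DecidableEq V] (G : SimpleGraph V) [DecidableRel G.Adj]
    (T : Finset V) (n : ℕ) (ε : ℝ) : ℝ :=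
  ∑ v ∈ T, Real.logb 2 (1 + (n : ℝ) / (1 + (numAdj G T v : ℝ) * ε * n))

/-- `Ṽ` is an independent set of `G`: no two of its vertices are adjacent. -/
def IsIndepSet {V : Type*} (G : SimpleGraph V) (T : Finset V) : Prop :=
  ∀ u ∈ T, ∀ w ∈ T, ¬ G.Adj u w

/-- The rate `log₂(1 + n/(1 + k·ε·n))` of a vertex with `k` active neighbours. -/
noncomputable def vertexRate (k n : ℕ) (ε : ℝ) : ℝ :=
  Real.logb 2 (1 + (n : ℝ) / (1 + (k : ℝ) * ε * n))

lemma vertexRate_antitone {ε : ℝ} (hε : 0 ≤ ε) (n : ℕ) {j k : ℕ} (hjk : j ≤ k) :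
    vertexRate k n ε ≤ vertexRate j n ε := by
  unfold vertexRate
  have hjk' : (j : ℝ) ≤ k := by exact_mod_cast hjk
  apply Real.logb_le_logb_of_le (by norm_num) (by positivity)
  gcongr

lemma tendsto_vertexRate {k : ℕ} (hk : k ≠ 0) :
    Tendsto (fun p : ℕ × ℝ => vertexRate k p.1 p.2) (atTop ×ˢ 𝓝[<] (1 : ℝ))
      (𝓝 (Real.logb 2 (1 + 1 / k))) := by
  have hn : Tendsto (fun p : ℕ × ℝ => (p.1 : ℝ)) (atTop ×ˢ 𝓝[<] (1 : ℝ)) atTop :=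
    tendsto_natCast_atTop_atTop.comp tendsto_fst
  have he : Tendsto (fun p : ℕ × ℝ => p.2) (atTop ×ˢ 𝓝[<] (1 : ℝ)) (𝓝 1) :=
    tendsto_snd.mono_right nhdsWithin_le_nhds
  have hk' : (k : ℝ) ≠ 0 := by exact_mod_cast hk
  have hden : Tendsto (fun p : ℕ × ℝ => (p.1 : ℝ)⁻¹ + k * p.2) (atTop ×ˢ 𝓝[<] (1 : ℝ))
      (𝓝 k) := by
    simpa using (tendsto_inv_atTop_zero.comp hn).add (he.const_mul (k : ℝ))
  have harg : Tendsto (fun p : ℕ × ℝ => 1 + ((p.1 : ℝ)⁻¹ + k * p.2)⁻¹)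
      (atTop ×ˢ 𝓝[<] (1 : ℝ)) (𝓝 (1 + 1 / k)) := by
    simpa using (hden.inv₀ hk').const_add 1
  have hlog := harg.log (by positivity)
  refine (hlog.div_const (Real.log 2)).congr' ?_
  filter_upwards [hn.eventually_gt_atTop 0] with p hp
  have : (p.1 : ℝ) / (1 + k * p.2 * p.1) = ((p.1 : ℝ)⁻¹ + k * p.2)⁻¹ := by
    rw [show (p.1 : ℝ)⁻¹ + k * p.2 = (1 + k * p.2 * p.1) / p.1 by field_simp, inv_div]
  rw [vertexRate, this, Real.logb]

lemma tendsto_vertexRate_zero :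
    Tendsto (fun p : ℕ × ℝ => vertexRate 0 p.1 p.2) (atTop ×ˢ 𝓝[<] (1 : ℝ)) atTop := by
  have hn : Tendsto (fun p : ℕ × ℝ => (p.1 : ℝ)) (atTop ×ˢ 𝓝[<] (1 : ℝ)) atTop :=
    tendsto_natCast_atTop_atTop.comp tendsto_fst
  simpa [vertexRate, Function.comp_def] using
    (Real.tendsto_logb_atTop (b := 2) (by norm_num)).comp (tendsto_atTop_add_const_left _ 1 hn)

lemma logb_lt_nat_mul_sub {a b c : ℝ} (l : ℕ) (ha : 0 < a) (hb : 0 < b) (hc : 0 < c)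
    (h : a < (b / c) ^ l) : Real.logb 2 a < l * (Real.logb 2 b - Real.logb 2 c) := by
  rw [← Real.logb_div hb.ne' hc.ne', ← Real.logb_pow]
  exact Real.logb_lt_logb (by norm_num) ha h

lemma eventually_vertexRate_lt {i j k l : ℕ} (hi : i ≠ 0) (hj : j ≠ 0) (hk : k ≠ 0)
    (h : 1 + 1 / (i : ℝ) < ((1 + 1 / (j : ℝ)) / (1 + 1 / (k : ℝ))) ^ l) :
    ∀ᶠ p : ℕ × ℝ in atTop ×ˢ 𝓝[<] (1 : ℝ),
      vertexRate i p.1 p.2 < l * (vertexRate j p.1 p.2 - vertexRate k p.1 p.2) :=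
  (tendsto_vertexRate hi).eventually_lt
    (((tendsto_vertexRate hj).sub (tendsto_vertexRate hk)).const_mul (l : ℝ))
    (logb_lt_nat_mul_sub l (by positivity) (by positivity) (by positivity) h)

lemma eventually_vertexRate_one_lt :
    ∀ᶠ p : ℕ × ℝ in atTop ×ˢ 𝓝[<] (1 : ℝ),
      vertexRate 1 p.1 p.2 < vertexRate 0 p.1 p.2 - vertexRate 1 p.1 p.2 := by
  have h1 := (tendsto_vertexRate one_ne_zero).eventually_lt_const
    (lt_add_one (Real.logb 2 (1 + 1 / (1 : ℕ))))
  filter_upwards [h1, tendsto_vertexRate_zero.eventually_gt_atTop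
    (2 * (Real.logb 2 (1 + 1 / (1 : ℕ)) + 1))] with p h h'
  linarith

lemma exists_of_eventually_prod {P : ℕ → ℝ → Prop}
    (h : ∀ᶠ p : ℕ × ℝ in atTop ×ˢ 𝓝[<] (1 : ℝ), P p.1 p.2) :
    ∃ N : ℕ, ∃ ε₀ ∈ Set.Ioo (0 : ℝ) 1, ∀ n : ℕ, N ≤ n → ∀ ε ∈ Set.Ioo ε₀ (1 : ℝ), P n ε := by
  obtain ⟨p, hp, q, hq, hpq⟩ := eventually_prod_iff.mp h
  obtain ⟨N, hN⟩ := eventually_atTop.mp hp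
  obtain ⟨ε₀, hε₀, hsub⟩ :=
    (mem_nhdsLT_iff_exists_mem_Ico_Ioo_subset (show (1 / 2 : ℝ) < 1 by norm_num)).mp hq
  exact ⟨N, ε₀, ⟨by linarith [hε₀.1], hε₀.2⟩, fun n hn ε hε => hpq (hN n hn) (hsub hε)⟩

section Graph

variable {V : Type*} [DecidableEq V] (G : SimpleGraph V) [DecidableRel G.Adj]

lemma numAdj_le_degree [Fintype V] (T : Finset V) (v : V) : numAdj G T v ≤ G.degree v := by
  rw [numAdj, ← G.card_neighborFinset_eq_degree]
  apply Finset.card_le_card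
  intro u hu
  simpa using (Finset.mem_filter.mp hu).2

lemma numAdj_pos {T : Finset V} {v w : V} (hw : w ∈ T) (h : G.Adj v w) : 0 < numAdj G T v :=
  Finset.card_pos.mpr ⟨w, Finset.mem_filter.mpr ⟨hw, h⟩⟩

lemma numAdj_erase {T : Finset V} {v : V} (hv : v ∈ T) (w : V) :
    numAdj G (T.erase v) w = if G.Adj v w then numAdj G T w - 1 else numAdj G T w := by
  unfold numAdj
  rw [Finset.filter_erase]
  split_ifs with h
  · exact Finset.card_erase_of_mem (Finset.mem_filter.mpr ⟨hv, h.symm⟩)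
  · rw [Finset.erase_eq_of_notMem]
    exact fun hm => h (Finset.mem_filter.mp hm).2.symm

/-- Dropping `v` loses the rate of `v` and raises the rates of its neighbours. -/
lemma sumRate_erase_sub {T : Finset V} {v : V} (hv : v ∈ T) (n : ℕ) (ε : ℝ) :
    sumRate G (T.erase v) n ε - sumRate G T n ε =
      ∑ w ∈ T.filter (fun u => G.Adj v u),
        (vertexRate (numAdj G T w - 1) n ε - vertexRate (numAdj G T w) n ε)
      - vertexRate (numAdj G T v) n ε := by
  change ∑ w ∈ T.erase v, vertexRate (numAdj G (T.erase v) w) n ε -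
    ∑ w ∈ T, vertexRate (numAdj G T w) n ε = _
  rw [← Finset.add_sum_erase T _ hv, sub_add_eq_sub_sub_swap, ← Finset.sum_sub_distrib,
    ← Finset.erase_eq_of_notMem (s := T.filter (fun u => G.Adj v u)) (a := v) (by simp),
    ← Finset.filter_erase, Finset.sum_filter]
  congr 1
  refine Finset.sum_congr rfl fun w _ => ?_
  rw [numAdj_erase G hv]
  split_ifs <;> simp

lemma sumRate_lt_erase_of_forall {T : Finset V} {v : V} (hv : v ∈ T) {n : ℕ} {ε c : ℝ}
    (hc : ∀ w ∈ T, G.Adj v w →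
      c ≤ vertexRate (numAdj G T w - 1) n ε - vertexRate (numAdj G T w) n ε)
    (h : vertexRate (numAdj G T v) n ε < numAdj G T v * c) :
    sumRate G T n ε < sumRate G (T.erase v) n ε := by
  rw [← sub_pos, sumRate_erase_sub G hv, sub_pos]
  refine h.trans_le ?_
  rw [← nsmul_eq_mul]
  refine Finset.card_nsmul_le_sum _ _ _ fun w hw => ?_
  exact hc w (Finset.mem_filter.mp hw).1 (Finset.mem_filter.mp hw).2

lemma sumRate_lt_erase_of_numAdj_eq_one {T : Finset V} {v w : V} (hv : v ∈ T) (hw : w ∈ T)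
    (hvw : G.Adj v w) (hw1 : numAdj G T w = 1) {n : ℕ} {ε : ℝ} (hε : 0 ≤ ε)
    (h : vertexRate 1 n ε < vertexRate 0 n ε - vertexRate 1 n ε) :
    sumRate G T n ε < sumRate G (T.erase v) n ε := by
  rw [← sub_pos, sumRate_erase_sub G hv, sub_pos]
  refine (vertexRate_antitone hε n (numAdj_pos G hw hvw)).trans_lt (h.trans_le ?_)
  have := Finset.single_le_sum
    (f := fun w => vertexRate (numAdj G T w - 1) n ε - vertexRate (numAdj G T w) n ε)
    (fun u _ => sub_nonneg.mpr (vertexRate_antitone hε n (Nat.sub_le (numAdj G T u) 1)))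
    (Finset.mem_filter.mpr ⟨hw, hvw⟩)
  simpa [hw1] using this

end Graph

/-- If every vertex of `G` has degree at most 3 and `Ṽ ⊆ V` is not an independent set, then
there is a vertex `v ∈ Ṽ`, a natural number `N`, and `ε₀ ∈ (0,1)` such that for all `n ≥ N`
and all `ε ∈ (ε₀, 1)`, dropping `v` strictly increases the sum rate. -/
theorem exists_drop_increases_sumRate {V : Type*} [Fintype V] [DecidableEq V]
    (G : SimpleGraph V) [DecidableRel G.Adj] (hdeg : ∀ v : V, G.degree v ≤ 3)
    (T : Finset V) (hT : ¬ IsIndepSet G T) :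
    ∃ v ∈ T, ∃ N : ℕ, ∃ ε₀ ∈ Set.Ioo (0 : ℝ) 1,
      ∀ n : ℕ, N ≤ n → ∀ ε ∈ Set.Ioo ε₀ (1 : ℝ),
        sumRate G T n ε < sumRate G (T.erase v) n ε := by
  suffices H : ∃ v ∈ T, ∀ᶠ p : ℕ × ℝ in atTop ×ˢ 𝓝[<] (1 : ℝ),
      sumRate G T p.1 p.2 < sumRate G (T.erase v) p.1 p.2 by
    obtain ⟨v, hv, h⟩ := H
    exact ⟨v, hv, exists_of_eventually_prod h⟩
  have hle (w : V) : numAdj G T w ≤ 3 := (numAdj_le_degree G T w).trans (hdeg w)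
  by_cases hA : ∃ v ∈ T, ∃ w ∈ T, G.Adj v w ∧ numAdj G T w = 1
  · obtain ⟨v, hv, w, hw, hvw, hw1⟩ := hA
    have hpos : ∀ᶠ p : ℕ × ℝ in atTop ×ˢ 𝓝[<] (1 : ℝ), 0 < p.2 :=
      (tendsto_snd.mono_right nhdsWithin_le_nhds).eventually_const_lt one_pos
    refine ⟨v, hv, ?_⟩
    filter_upwards [hpos, eventually_vertexRate_one_lt] with p hp h
    exact sumRate_lt_erase_of_numAdj_eq_one G hv hw hvw hw1 hp.le h
  have htwo (v) (hv : v ∈ T) (w) (hw : w ∈ T) (h : G.Adj v w) : 2 ≤ numAdj G T w := by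
    have h0 := numAdj_pos G hv h.symm
    have h1 : numAdj G T w ≠ 1 := fun h1 => hA ⟨v, hv, w, hw, h, h1⟩
    omega
  by_cases hB : ∃ v ∈ T, numAdj G T v = 3
  · obtain ⟨v, hv, hv3⟩ := hB
    refine ⟨v, hv, ?_⟩
    filter_upwards [eventually_vertexRate_lt (i := 3) (j := 1) (k := 2) (l := 3)
        (by norm_num) (by norm_num) (by norm_num) (by norm_num),
      eventually_vertexRate_lt (i := 3) (j := 2) (k := 3) (l := 3)
        (by norm_num) (by norm_num) (by norm_num) (by norm_num)] with p h12 h23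
    refine sumRate_lt_erase_of_forall G hv (c := min (vertexRate 1 p.1 p.2 - vertexRate 2 p.1 p.2)
      (vertexRate 2 p.1 p.2 - vertexRate 3 p.1 p.2)) (fun w hw hvw => ?_) ?_
    · obtain h | h : numAdj G T w = 2 ∨ numAdj G T w = 3 := by
        have := htwo v hv w hw hvw
        have := hle w
        omega
      · simp [h]
      · simp [h]
    · rw [hv3, mul_min_of_nonneg _ _ (by positivity)]
      exact lt_min h12 h23
  · obtain ⟨v, hv, w, hw, hvw⟩ : ∃ v ∈ T, ∃ w ∈ T, G.Adj v w := by
      simpa [IsIndepSet] using hT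
    have heq (x) (hx : x ∈ T) (y) (hy : y ∈ T) (h : G.Adj x y) : numAdj G T y = 2 := by
      have h2 := htwo x hx y hy h
      have h3 : numAdj G T y ≠ 3 := fun h3 => hB ⟨y, hy, h3⟩
      have := hle y
      omega
    refine ⟨v, hv, ?_⟩
    filter_upwards [eventually_vertexRate_lt (i := 2) (j := 1) (k := 2) (l := 2)
      (by norm_num) (by norm_num) (by norm_num) (by norm_num)] with p h
    refine sumRate_lt_erase_of_forall G hv
      (c := vertexRate 1 p.1 p.2 - vertexRate 2 p.1 p.2) (fun u hu hvu => ?_) ?_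
    · rw [heq v hv u hu hvu]
    · rwa [heq w hw v hv hvw.symm]
end

section
/- Let G be a simple graph on a finite vertex set V in which every vertex has degree at most 3. Then there exist a natural number N and ε₀ ∈ (0, 1) such that for all natural numbers n ≥ N and all ε ∈ (ε₀, 1): every subset V* ⊆ V that maximizes the sum rate R^s(·, n, ε) over all subsets of V is a maximum independent set of G. -/
open Filter Topology

/-- `Ṽ` is a maximum independent set of `G`: an independent set of maximum cardinality. -/
def IsMaxIndepSet {V : Type*} (G : SimpleGraph V) (T : Finset V) : Prop :=
  IsIndepSet G T ∧ ∀ W : Finset V, IsIndepSet G W → W.card ≤ T.card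

theorem numAdj_eq_zero_iff {V : Type*} [DecidableEq V] {G : SimpleGraph V} [DecidableRel G.Adj]
    {T : Finset V} {v : V} : numAdj G T v = 0 ↔ ∀ u ∈ T, ¬ G.Adj v u := by
  simp [numAdj, Finset.filter_eq_empty_iff]

theorem IsIndepSet.sumRate_eq {V : Type*} [DecidableEq V] {G : SimpleGraph V}
    [DecidableRel G.Adj] {T : Finset V} (hT : IsIndepSet G T) (n : ℕ) (ε : ℝ) :
    sumRate G T n ε = T.card * Real.logb 2 (1 + n) := by
  have h : ∀ v ∈ T, Real.logb 2 (1 + (n : ℝ) / (1 + (numAdj G T v : ℝ) * ε * n)) =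
      Real.logb 2 (1 + n) := fun v hv => by
    simp [numAdj_eq_zero_iff.2 (hT v hv)]
  rw [sumRate, Finset.sum_congr rfl h, Finset.sum_const, nsmul_eq_mul]

/-- The isolated vertices of `T`, together with any one further vertex of `T`, are independent. -/
theorem isIndepSet_insert_isolated {V : Type*} [DecidableEq V] (G : SimpleGraph V)
    [DecidableRel G.Adj] {T : Finset V} {u : V} (hu : u ∈ T) :
    IsIndepSet G (insert u (T.filter fun v => numAdj G T v = 0)) := by
  intro a ha b hb hab
  simp only [Finset.mem_insert, Finset.mem_filter, numAdj_eq_zero_iff] at ha hb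
  rcases ha with rfl | ⟨haT, ha⟩
  · rcases hb with rfl | ⟨-, hb⟩
    · exact G.irrefl hab
    · exact hb _ hu hab.symm
  · rcases hb with rfl | ⟨hbT, -⟩
    · exact ha _ hu hab
    · exact ha _ hbT hab

theorem logb_rate_le_two {d : ℕ} (hd : d ≠ 0) (n : ℕ) {ε : ℝ} (hε : 1 / 2 < ε) :
    Real.logb 2 (1 + (n : ℝ) / (1 + (d : ℝ) * ε * n)) ≤ 2 := by
  have hd1 : (1 : ℝ) ≤ d := by exact_mod_cast Nat.one_le_iff_ne_zero.2 hd
  have hn : (0 : ℝ) ≤ n := n.cast_nonneg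
  have hdε : 1 / 2 ≤ (d : ℝ) * ε := by nlinarith
  have hpos : 0 < 1 + (d : ℝ) * ε * n := by positivity
  have hq : (n : ℝ) / (1 + (d : ℝ) * ε * n) ≤ 3 := by
    rw [div_le_iff₀ hpos]
    nlinarith [mul_le_mul_of_nonneg_right hdε hn]
  rw [Real.logb_le_iff_le_rpow (by norm_num) (by positivity)]
  norm_num
  linarith

/-- Up to a bounded error, only the isolated vertices of `T` contribute to the sum rate. -/
theorem sumRate_le {V : Type*} [Fintype V] [DecidableEq V] (G : SimpleGraph V)
    [DecidableRel G.Adj] (T : Finset V) (n : ℕ) {ε : ℝ} (hε : 1 / 2 < ε) :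
    sumRate G T n ε ≤ (T.filter fun v => numAdj G T v = 0).card * Real.logb 2 (1 + n) +
      2 * Fintype.card V := by
  rw [sumRate, ← Finset.sum_filter_add_sum_filter_not T (fun v => numAdj G T v = 0)]
  refine add_le_add (le_of_eq ?_) ?_
  · rw [← nsmul_eq_mul]
    refine Finset.sum_eq_card_nsmul fun v hv => ?_
    simp [(Finset.mem_filter.1 hv).2]
  · refine (Finset.sum_le_card_nsmul _ _ 2 fun v hv =>
      logb_rate_le_two (Finset.mem_filter.1 hv).2 n hε).trans ?_
    rw [nsmul_eq_mul, mul_comm]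
    gcongr
    exact Finset.card_le_univ _

/-- If every vertex of `G` has degree at most 3, then for all sufficiently large `n` and all
`ε` sufficiently close to (and below) 1, every subset maximizing the sum rate is a maximum
independent set of `G`. -/
theorem maxSumRate_isMaxIndepSet {V : Type*} [Fintype V] [DecidableEq V]
    (G : SimpleGraph V) [DecidableRel G.Adj] (hdeg : ∀ v : V, G.degree v ≤ 3) :
    ∃ N : ℕ, ∃ ε₀ ∈ Set.Ioo (0 : ℝ) 1,
      ∀ n : ℕ, N ≤ n → ∀ ε ∈ Set.Ioo ε₀ (1 : ℝ),
        ∀ Vstar : Finset V, (∀ T : Finset V, sumRate G T n ε ≤ sumRate G Vstar n ε) →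
          IsMaxIndepSet G Vstar := by
  refine ⟨4 ^ Fintype.card V, 1 / 2, by norm_num, fun n hn ε hε Vstar hmax => ?_⟩
  have hL : 2 * (Fintype.card V : ℝ) < Real.logb 2 (1 + n) := by
    rw [Real.lt_logb_iff_rpow_lt (by norm_num) (by positivity), Real.rpow_mul (by norm_num),
      Real.rpow_natCast]
    have : (4 : ℝ) ^ Fintype.card V ≤ n := by exact_mod_cast hn
    norm_num
    linarith
  have hL0 : 0 < Real.logb 2 (1 + (n : ℝ)) := lt_of_le_of_lt (by positivity) hL
  have hind : IsIndepSet G Vstar := by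
    intro u hu w hw huw
    have h := (hmax (insert u (Vstar.filter fun v => numAdj G Vstar v = 0))).trans
      (sumRate_le G Vstar n hε.1)
    rw [(isIndepSet_insert_isolated G hu).sumRate_eq, Finset.card_insert_of_notMem] at h
    · push_cast at h
      linarith
    · rw [Finset.mem_filter, numAdj_eq_zero_iff]
      exact fun hu' => hu'.2 w hw huw
  refine ⟨hind, fun W hW => ?_⟩
  have h := hmax W
  rw [hW.sumRate_eq, hind.sumRate_eq] at h
  exact_mod_cast le_of_mul_le_mul_right h hL0
end

section
/- Let L be a finite set of players, and for each l ∈ L let Z_l be a nonempty set of strategies; write Z = Π_{l ∈ L} Z_l for the set of strategy profiles. For each l ∈ L let V_l : Z → ℝ be a utility function and let T_l ⊆ L be a set with l ∈ T_l, such that for every l' ∉ T_l the function V_{l'} does not depend on the l-th coordinate (i.e., V_{l'}(z) = V_{l'}(z') whenever z and z' agree on all coordinates other than l). Define the payoff Y_l(z) = ∑_{l' ∈ T_l} V_{l'}(z) and the function Ψ(z) = ∑_{l ∈ L} V_l(z). Then Ψ is an exact potential for the game with payoffs (Y_l): for every player l, every profile z ∈ Z, and every strategy a ∈ Z_l, Y_l(a,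 z_{−l}) − Y_l(z) = Ψ(a, z_{−l}) − Ψ(z), where (a, z_{−l}) denotes the profile obtained from z by replacing its l-th coordinate with a. -/
/-- Let `L` be a finite set of players with nonempty strategy sets `Z l`. Suppose each
utility `V l'` with `l' ∉ T l` does not depend on the `l`-th coordinate (where `l ∈ T l`).
Then `Ψ(z) = ∑_l V_l(z)` is an exact potential for the payoffs `Y_l(z) = ∑_{l' ∈ T l} V_{l'}(z)`. -/
theorem potential_of_local_utilities {L : Type*} [Fintype L] [DecidableEq L]
    (Z : L → Type*) [∀ l, Nonempty (Z l)]
    (V : L → (∀ l, Z l) → ℝ) (T : L → Finset L) (hTl : ∀ l : L, l ∈ T l)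
    (hloc : ∀ l l' : L, l' ∉ T l → ∀ z z' : ∀ k, Z k,
      (∀ k : L, k ≠ l → z k = z' k) → V l' z = V l' z') :
    ∀ (l : L) (z : ∀ k, Z k) (a : Z l),
      (∑ l' ∈ T l, V l' (Function.update z l a)) - (∑ l' ∈ T l, V l' z) =
        (∑ k : L, V k (Function.update z l a)) - (∑ k : L, V k z) := by
  intro l z a
  rw [← Finset.sum_sub_distrib, ← Finset.sum_sub_distrib]
  refine Finset.sum_subset (Finset.subset_univ _) fun k _ hk => sub_eq_zero.mpr ?_
  exact hloc l k hk _ _ fun j hj => Function.update_of_ne hj a z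
end

section
/- Let L be a finite nonempty set of players with nonempty finite strategy sets Z_l and profile set Z = Π_{l ∈ L} Z_l, let Y_l : Z → ℝ be payoff functions, and suppose Ψ : Z → ℝ is an exact potential for (Y_l), i.e., Y_l(a, z_{−l}) − Y_l(z) = Ψ(a, z_{−l}) − Ψ(z) for every player l, profile z, and strategy a ∈ Z_l. Then every profile z* that globally maximizes Ψ over Z is a pure strategy Nash equilibrium: Y_l(z*) ≥ Y_l(a, z*_{−l}) for every player l and every a ∈ Z_l. In particular, the game has at least one pure strategy Nash equilibrium. -/
/-- In a finite game with an exact potential `Ψ`, every global maximizer of `Ψ` is a pure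
strategy Nash equilibrium; in particular, the game has at least one pure strategy Nash
equilibrium. -/
theorem potential_game_maximizer_is_NE {L : Type*} [Fintype L] [Nonempty L] [DecidableEq L]
    (Z : L → Type*) [∀ l, Fintype (Z l)] [∀ l, Nonempty (Z l)]
    (Y : L → (∀ l, Z l) → ℝ) (Ψ : (∀ l, Z l) → ℝ)
    (hpot : ∀ (l : L) (z : ∀ k, Z k) (a : Z l),
      Y l (Function.update z l a) - Y l z = Ψ (Function.update z l a) - Ψ z) :
    (∀ zs : ∀ k, Z k, (∀ z : ∀ k, Z k, Ψ z ≤ Ψ zs) →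
      ∀ (l : L) (a : Z l), Y l (Function.update zs l a) ≤ Y l zs) ∧
    (∃ zs : ∀ k, Z k, ∀ (l : L) (a : Z l), Y l (Function.update zs l a) ≤ Y l zs) := by
  have maximizer_isNash : ∀ zs : ∀ k, Z k, (∀ z : ∀ k, Z k, Ψ z ≤ Ψ zs) →
      ∀ (l : L) (a : Z l), Y l (Function.update zs l a) ≤ Y l zs := by
    intro zs hmax l a
    linarith [hpot l zs a, hmax (Function.update zs l a)]
  obtain ⟨zs, hmax⟩ := Finite.exists_max Ψ
  exact ⟨maximizer_isNash, zs, maximizer_isNash zs hmax⟩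
end

section
/- Let L be a finite set of players with nonempty finite strategy sets Z_l and profile set Z = Π_{l ∈ L} Z_l, let Y_l : Z → ℝ be payoff functions with exact potential Ψ : Z → ℝ (i.e., Y_l(a, z_{−l}) − Y_l(z) = Ψ(a, z_{−l}) − Ψ(z) for all l, z, a), and let β > 0. Fix a player l and define the single-site Gibbs update probabilities P_l(z, a) = exp(β·Y_l(a, z_{−l})) / ∑_{b ∈ Z_l} exp(β·Y_l(b, z_{−l})) for a ∈ Z_l. Then for every profile z and all a, b ∈ Z_l, the detailed balance equation π(a, z_{−l}) · P_l((a, z_{−l}), b) = π(b, z_{−l}) · P_l((b, z_{−l}), a) holds, where π(z) = exp(β·Ψ(z)) / ∑_{z' ∈ Z} exp(β·Ψ(z')). -/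
/-- In a finite game with an exact potential `Ψ` and `β > 0`, the Gibbs distribution
`π(z) = exp(β·Ψ(z))/∑_{z'} exp(β·Ψ(z'))` satisfies detailed balance with respect to the
single-site Gibbs update of any fixed player `l`, whose update probabilities are
`P_l(z, a) = exp(β·Y_l(a, z_{−l})) / ∑_{b} exp(β·Y_l(b, z_{−l}))`. -/
theorem gibbs_update_detailed_balance {L : Type*} [Fintype L] [DecidableEq L]
    (Z : L → Type*) [∀ l, Fintype (Z l)] [∀ l, Nonempty (Z l)]
    (Y : L → (∀ l, Z l) → ℝ) (Ψ : (∀ l, Z l) → ℝ) (β : ℝ) (hβ : 0 < β)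
    (hpot : ∀ (l : L) (z : ∀ k, Z k) (a : Z l),
      Y l (Function.update z l a) - Y l z = Ψ (Function.update z l a) - Ψ z)
    (l : L) :
    ∀ (z : ∀ k, Z k) (a b : Z l),
      (Real.exp (β * Ψ (Function.update z l a)) /
          ∑ z' : ∀ k, Z k, Real.exp (β * Ψ z')) *
        (Real.exp (β * Y l (Function.update (Function.update z l a) l b)) /
          ∑ c : Z l, Real.exp (β * Y l (Function.update (Function.update z l a) l c))) =
      (Real.exp (β * Ψ (Function.update z l b)) /
          ∑ z' : ∀ k, Z k, Real.exp (β * Ψ z')) *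
        (Real.exp (β * Y l (Function.update (Function.update z l b) l a)) /
          ∑ c : Z l, Real.exp (β * Y l (Function.update (Function.update z l b) l c))) := by
  intro z a b
  simp only [Function.update_idem]
  rw [div_mul_div_comm, div_mul_div_comm, ← Real.exp_add, ← Real.exp_add]
  have hexp : β * Ψ (Function.update z l a) + β * Y l (Function.update z l b) =
      β * Ψ (Function.update z l b) + β * Y l (Function.update z l a) := by
    linear_combination β * (hpot l z b - hpot l z a)
  rw [hexp]
end

section
/- Let L be a finite set of players with nonempty strategy sets Z_l and profile set Z = Π_{l ∈ L} Z_l, let Y_l : Z → ℝ be payoff functions with exact potential Ψ : Z → ℝ (i.e., Y_l(a, z_{−l}) − Y_l(z) = Ψ(a, z_{−l}) − Ψ(z) for all l, z, a). Let L̂ ⊆ L be a set of players such that for each l ∈ L̂, the payoff Y_l does not depend on the coordinates of the other players in L̂ (i.e., Y_l(z) = Y_l(z') whenever z_l = z'_l and z, z' agree on all coordinates outside L̂). Then for any two profiles ẑ and z̃ that agree on all coordinates outside L̂, Ψ(z̃) − Ψ(ẑ) = ∑_{l ∈ L̂} (Y_l(z̃) − Y_l(ẑ)). -/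
/-- In a game with an exact potential `Ψ`, if `L̂` is a set of players such that the payoff
of each `l ∈ L̂` does not depend on the strategies of the other players in `L̂`, then for any
two profiles `ẑ`, `z̃` agreeing outside `L̂`, the change in potential equals the sum of the
payoff changes of the players in `L̂`. -/
theorem potential_change_eq_sum_payoff_changes {L : Type*} [Fintype L] [DecidableEq L]
    (Z : L → Type*) [∀ l, Nonempty (Z l)]
    (Y : L → (∀ l, Z l) → ℝ) (Ψ : (∀ l, Z l) → ℝ)
    (hpot : ∀ (l : L) (z : ∀ k, Z k) (a : Z l),
      Y l (Function.update z l a) - Y l z = Ψ (Function.update z l a) - Ψ z)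
    (Lhat : Finset L)
    (hind : ∀ l ∈ Lhat, ∀ z z' : ∀ k, Z k, z l = z' l →
      (∀ k : L, k ∉ Lhat → z k = z' k) → Y l z = Y l z')
    (zh zt : ∀ k, Z k) (hagree : ∀ k : L, k ∉ Lhat → zh k = zt k) :
    Ψ zt - Ψ zh = ∑ l ∈ Lhat, (Y l zt - Y l zh) := by
  have key : ∀ S : Finset L, S ⊆ Lhat →
      Ψ (S.piecewise zt zh) - Ψ zh = ∑ l ∈ S, (Y l zt - Y l zh) := by
    intro S
    induction S using Finset.induction_on with
    | empty => simp
    | insert j S hj ih =>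
      intro hS
      obtain ⟨hjL, hSL⟩ := Finset.insert_subset_iff.mp hS
      have outside : ∀ k ∉ Lhat, S.piecewise zt zh k = zh k := fun k hk =>
        Finset.piecewise_eq_of_notMem _ _ _ fun h => hk (hSL h)
      have h_after : Y j (Function.update (S.piecewise zt zh) j (zt j)) = Y j zt := by
        refine hind j hjL _ _ (by simp) fun k hk => ?_
        have hkj : k ≠ j := fun h => hk (h ▸ hjL)
        rw [Function.update_of_ne hkj, outside k hk, hagree k hk]
      have h_before : Y j (S.piecewise zt zh) = Y j zh :=
        hind j hjL _ _ (Finset.piecewise_eq_of_notMem _ _ _ hj) outside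
      have h_step := hpot j (S.piecewise zt zh) (zt j)
      rw [h_after, h_before] at h_step
      rw [Finset.piecewise_insert, Finset.sum_insert hj]
      linarith [ih hSL]
  have h_full : Lhat.piecewise zt zh = zt := by
    funext k
    by_cases hk : k ∈ Lhat
    · exact Finset.piecewise_eq_of_mem _ _ _ hk
    · rw [Finset.piecewise_eq_of_notMem _ _ _ hk, hagree k hk]
  simpa only [h_full] using key Lhat subset_rfl
end
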